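/- arXiv:1908.11082 — 6 statements merged into one kernel-verified Lean document; each statement's English description precedes it below -/
import Mathlib

section
/- Let A be a linear measurement map on block signals with p blocks of length n, let k ≥ 1 be a natural number, and let x be block k-sparse. Suppose there exists a real q > 1 such that every nonzero z in the kernel of A satisfies 2·k^{1-1/q}·‖z‖_{2,q} < ‖z‖_{2,1} (equivalently, k < 2^{q/(1-q)}·k_q(z)). Then x is the unique solution of the noise-free block basis pursuit: every z with A z = A x and z ≠ x satisfies ‖x‖_{2,1} < ‖z‖_{2,1}. -/
open scoped BigOperators

noncomputable section

/-- Mixed ℓ₂/ℓ₁ norm of a block signal: sum of the Euclidean norms of the blocks. -/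
def mnorm1 {p n : ℕ} (x : Fin p → EuclideanSpace ℝ (Fin n)) : ℝ := ∑ i, ‖x i‖

/-- Mixed ℓ₂/ℓ_q norm of a block signal. -/
def mnorm {p n : ℕ} (q : ℝ) (x : Fin p → EuclideanSpace ℝ (Fin n)) : ℝ :=
  (∑ i, ‖x i‖ ^ q) ^ (1 / q)

/-- Hölder's inequality against the constant function on a finite set. -/
theorem sum_le_card_rpow_mul_sum_rpow {ι : Type*} (S : Finset ι) (f : ι → ℝ)
    (hf : ∀ i ∈ S, 0 ≤ f i) {q : ℝ} (hq : 1 < q) :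
    ∑ i ∈ S, f i ≤ (S.card : ℝ) ^ (1 - 1 / q) * (∑ i ∈ S, f i ^ q) ^ (1 / q) := by
  have h := Real.inner_le_Lp_mul_Lq_of_nonneg S (Real.HolderConjugate.conjExponent hq).symm
    (f := fun _ => 1) (g := f) (fun _ _ => zero_le_one) hf
  have he : 1 / q.conjExponent = 1 - 1 / q := by
    have := (Real.HolderConjugate.conjExponent hq).inv_add_inv_eq_one
    simp only [one_div]
    linarith
  simpa [he] using h

/-- The part of a block signal carried by at most `k` blocks is controlled by its mixed norm. -/
theorem sum_norm_le_rpow_mul_mnorm {p n k : ℕ} (S : Finset (Fin p)) (hS : S.card ≤ k)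
    (h : Fin p → EuclideanSpace ℝ (Fin n)) {q : ℝ} (hq : 1 < q) :
    ∑ i ∈ S, ‖h i‖ ≤ (k : ℝ) ^ (1 - 1 / q) * mnorm q h := by
  have hq0 : 0 < q := one_pos.trans hq
  have hexp : 0 ≤ 1 - 1 / q := sub_nonneg.2 ((div_le_one hq0).2 hq.le)
  refine (sum_le_card_rpow_mul_sum_rpow S (fun i => ‖h i‖) (fun _ _ => norm_nonneg _) hq).trans ?_
  unfold mnorm
  gcongr
  exact Finset.subset_univ S

/-- The null space property on the support of `x` forces strict growth of the mixed norm. -/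
theorem mnorm1_lt_of_two_mul_sum_lt {p n : ℕ} (S : Finset (Fin p))
    (x z : Fin p → EuclideanSpace ℝ (Fin n)) (hx : ∀ i ∉ S, x i = 0)
    (h : 2 * ∑ i ∈ S, ‖(z - x) i‖ < mnorm1 (z - x)) : mnorm1 x < mnorm1 z := by
  have hpt : ∑ i ∈ S, ‖x i‖ ≤ ∑ i ∈ S, ‖z i‖ + ∑ i ∈ S, ‖(z - x) i‖ := by
    rw [← Finset.sum_add_distrib]
    exact Finset.sum_le_sum fun i _ => norm_le_norm_add_norm_sub (z i) (x i)
  have hxc : ∑ i ∈ Sᶜ, ‖x i‖ = 0 :=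
    Finset.sum_eq_zero fun i hi => by rw [hx i (Finset.mem_compl.1 hi), norm_zero]
  have hzc : ∑ i ∈ Sᶜ, ‖(z - x) i‖ = ∑ i ∈ Sᶜ, ‖z i‖ :=
    Finset.sum_congr rfl fun i hi => by
      rw [Pi.sub_apply, hx i (Finset.mem_compl.1 hi), sub_zero]
  unfold mnorm1 at h ⊢
  rw [← Finset.sum_add_sum_compl S] at h
  rw [← Finset.sum_add_sum_compl S (fun i => ‖x i‖), ← Finset.sum_add_sum_compl S (fun i => ‖z i‖)]
  linarith

/-- Sufficient condition via the q-ratio block sparsity for exact recovery by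
noise-free block basis pursuit. -/
theorem stmt_0 {p n m : ℕ}
    (A : (Fin p → EuclideanSpace ℝ (Fin n)) →ₗ[ℝ] EuclideanSpace ℝ (Fin m))
    (k : ℕ) (hk : 1 ≤ k)
    (x : Fin p → EuclideanSpace ℝ (Fin n))
    (hx : ∃ S : Finset (Fin p), S.card ≤ k ∧ ∀ i ∉ S, x i = 0)
    (hq : ∃ q : ℝ, 1 < q ∧
      ∀ z : Fin p → EuclideanSpace ℝ (Fin n), z ≠ 0 → A z = 0 →
        2 * (k : ℝ) ^ (1 - 1 / q) * mnorm q z < mnorm1 z) :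
    ∀ z : Fin p → EuclideanSpace ℝ (Fin n), A z = A x → z ≠ x → mnorm1 x < mnorm1 z := by
  obtain ⟨S, hS, hxS⟩ := hx
  obtain ⟨q, hq1, hker⟩ := hq
  intro z hz hne
  have hlt := hker (z - x) (sub_ne_zero.2 hne) (by rw [map_sub, hz, sub_self])
  have hle := sum_norm_le_rpow_mul_mnorm S hS (z - x) hq1
  exact mnorm1_lt_of_two_mul_sum_lt S x z hxS (by linarith)
end
end

section
/- Let 1 < q₂ ≤ q₁ < ∞ be reals, set q̃ = q₂(q₁-1)/(q₁(q₂-1)), and let s be a real with 1 ≤ s ≤ p^{1/q̃}. Then for any linear measurement map A, β_{q₁,s}(A) ≥ β_{q₂,s^{q̃}}(A). -/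
open scoped BigOperators

noncomputable section

/-- The q-ratio block sparsity k_q(x) = (‖x‖_{2,1}/‖x‖_{2,q})^{q/(q-1)}. -/
def blockSparsity {p n : ℕ} (q : ℝ) (x : Fin p → EuclideanSpace ℝ (Fin n)) : ℝ :=
  (mnorm1 x / mnorm q x) ^ (q / (q - 1))

/-- The q-ratio block constrained minimal singular value of a measurement map. -/
def bcmsv {p n m : ℕ} (q s : ℝ)
    (A : (Fin p → EuclideanSpace ℝ (Fin n)) →ₗ[ℝ] EuclideanSpace ℝ (Fin m)) : ℝ :=
  sInf {r : ℝ | ∃ z : Fin p → EuclideanSpace ℝ (Fin n),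
    z ≠ 0 ∧ blockSparsity q z ≤ s ∧ r = ‖A z‖ / mnorm q z}

section BlockNorms

variable {p n : ℕ}

lemma sum_rpow_norm_pos (q : ℝ) {z : Fin p → EuclideanSpace ℝ (Fin n)} (hz : z ≠ 0) :
    0 < ∑ i, ‖z i‖ ^ q := by
  obtain ⟨i, hi⟩ := Function.ne_iff.mp hz
  exact Finset.sum_pos' (fun j _ => Real.rpow_nonneg (norm_nonneg _) _)
    ⟨i, Finset.mem_univ i, Real.rpow_pos_of_pos (norm_pos_iff.mpr hi) _⟩

lemma mnorm_pos (q : ℝ) {z : Fin p → EuclideanSpace ℝ (Fin n)} (hz : z ≠ 0) :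
    0 < mnorm q z :=
  Real.rpow_pos_of_pos (sum_rpow_norm_pos q hz) _

lemma mnorm1_nonneg (z : Fin p → EuclideanSpace ℝ (Fin n)) : 0 ≤ mnorm1 z :=
  Finset.sum_nonneg fun _ _ => norm_nonneg _

lemma mnorm_rpow {q : ℝ} (hq : 0 < q) (z : Fin p → EuclideanSpace ℝ (Fin n)) :
    mnorm q z ^ q = ∑ i, ‖z i‖ ^ q := by
  rw [mnorm, one_div, Real.rpow_inv_rpow
    (Finset.sum_nonneg fun _ _ => Real.rpow_nonneg (norm_nonneg _) _) hq.ne']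

lemma norm_le_mnorm {q : ℝ} (hq : 0 < q) (z : Fin p → EuclideanSpace ℝ (Fin n)) (i : Fin p) :
    ‖z i‖ ≤ mnorm q z := by
  have hN : 0 ≤ mnorm q z :=
    Real.rpow_nonneg (Finset.sum_nonneg fun _ _ => Real.rpow_nonneg (norm_nonneg _) _) _
  rw [← Real.rpow_le_rpow_iff (norm_nonneg _) hN hq, mnorm_rpow hq]
  exact Finset.single_le_sum (f := fun j => ‖z j‖ ^ q)
    (fun j _ => Real.rpow_nonneg (norm_nonneg _) _) (Finset.mem_univ i)

/-- The mixed norms are antitone in the exponent. -/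
lemma mnorm_anti {q r : ℝ} (hq : 0 < q) (hqr : q ≤ r)
    {z : Fin p → EuclideanSpace ℝ (Fin n)} (hz : z ≠ 0) : mnorm r z ≤ mnorm q z := by
  have hr : 0 < r := hq.trans_le hqr
  have hN := mnorm_pos q hz
  rw [← Real.rpow_le_rpow_iff (mnorm_pos r hz).le hN.le hr, mnorm_rpow hr]
  calc ∑ i, ‖z i‖ ^ r = ∑ i, ‖z i‖ ^ q * ‖z i‖ ^ (r - q) := by
        refine Finset.sum_congr rfl fun i _ => ?_
        rw [← Real.rpow_add_of_nonneg (norm_nonneg _) hq.le (sub_nonneg.mpr hqr),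
          add_sub_cancel]
    _ ≤ ∑ i, ‖z i‖ ^ q * mnorm q z ^ (r - q) := by
        gcongr with i _
        exact norm_le_mnorm hq z i
    _ = mnorm q z ^ r := by
        rw [← Finset.sum_mul, ← mnorm_rpow hq, ← Real.rpow_add hN, add_sub_cancel]

lemma blockSparsity_le_rpow {q r : ℝ} (hq : 1 < q) (hqr : q ≤ r)
    {z : Fin p → EuclideanSpace ℝ (Fin n)} (hz : z ≠ 0) :
    blockSparsity q z ≤ blockSparsity r z ^ (q * (r - 1) / (r * (q - 1))) := by
  have hq1 : 0 < q - 1 := sub_pos.mpr hq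
  have hr1 : 0 < r - 1 := by linarith
  have hr : 0 < r := by linarith
  have hNr := mnorm_pos r hz
  have hexp : r / (r - 1) * (q * (r - 1) / (r * (q - 1))) = q / (q - 1) := by
    field_simp
  rw [blockSparsity, blockSparsity, ← Real.rpow_mul (div_nonneg (mnorm1_nonneg z) hNr.le), hexp]
  exact Real.rpow_le_rpow (div_nonneg (mnorm1_nonneg z) (mnorm_pos q hz).le)
    (div_le_div_of_nonneg_left (mnorm1_nonneg z) hNr (mnorm_anti (by linarith) hqr hz))
    (div_nonneg (by linarith) hq1.le)

lemma blockSparsity_single {q : ℝ} (hq : 0 < q) (i : Fin p) {v : EuclideanSpace ℝ (Fin n)}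
    (hv : v ≠ 0) : blockSparsity q (Pi.single i v) = 1 := by
  have h1 : mnorm1 (Pi.single i v) = ‖v‖ := by
    rw [mnorm1, Finset.sum_eq_single i (fun j _ hj => by simp [hj]) (by simp),
      Pi.single_eq_same]
  have hN : mnorm q (Pi.single i v) = ‖v‖ := by
    rw [mnorm, Finset.sum_eq_single i (fun j _ hj => by simp [hj, hq.ne']) (by simp),
      Pi.single_eq_same, one_div, Real.rpow_rpow_inv (norm_nonneg _) hq.ne']
  rw [blockSparsity, h1, hN, div_self (norm_ne_zero_iff.mpr hv), Real.one_rpow]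

end BlockNorms

/-- For 1 < q₂ ≤ q₁ and q̃ = q₂(q₁-1)/(q₁(q₂-1)), 1 ≤ s ≤ p^{1/q̃}:
β_{q₁,s}(A) ≥ β_{q₂,s^q̃}(A). -/
theorem stmt_1 {p n m : ℕ}
    (A : (Fin p → EuclideanSpace ℝ (Fin n)) →ₗ[ℝ] EuclideanSpace ℝ (Fin m))
    (q₁ q₂ : ℝ) (hq₂ : 1 < q₂) (hq : q₂ ≤ q₁)
    (s : ℝ) (hs1 : 1 ≤ s)
    (hs2 : s ≤ (p : ℝ) ^ (1 / (q₂ * (q₁ - 1) / (q₁ * (q₂ - 1))))) :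
    bcmsv q₂ (s ^ (q₂ * (q₁ - 1) / (q₁ * (q₂ - 1)))) A ≤ bcmsv q₁ s A := by
  have hq₁ : 1 < q₁ := hq₂.trans_le hq
  have hexp : 0 ≤ q₂ * (q₁ - 1) / (q₁ * (q₂ - 1)) :=
    div_nonneg (mul_nonneg (by linarith) (by linarith)) (mul_nonneg (by linarith) (by linarith))
  by_cases hne : ∃ z : Fin p → EuclideanSpace ℝ (Fin n), z ≠ 0
  · obtain ⟨z₀, hz₀⟩ := hne
    obtain ⟨i, hi⟩ := Function.ne_iff.mp hz₀
    refine le_csInf ⟨_, Pi.single i (z₀ i), by simpa using hi,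
      (blockSparsity_single (by linarith) i hi).trans_le hs1, rfl⟩ ?_
    rintro _ ⟨z, hz, hzs, rfl⟩
    have hsparse : 0 ≤ blockSparsity q₁ z :=
      Real.rpow_nonneg (div_nonneg (mnorm1_nonneg z) (mnorm_pos q₁ hz).le) _
    calc bcmsv q₂ (s ^ (q₂ * (q₁ - 1) / (q₁ * (q₂ - 1)))) A ≤ ‖A z‖ / mnorm q₂ z := by
          refine csInf_le ⟨0, ?_⟩ ⟨z, hz, (blockSparsity_le_rpow hq₂ hq hz).trans
            (Real.rpow_le_rpow hsparse hzs hexp), rfl⟩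
          rintro _ ⟨w, hw, -, rfl⟩
          exact div_nonneg (norm_nonneg _) (mnorm_pos q₂ hw).le
      _ ≤ ‖A z‖ / mnorm q₁ z :=
          div_le_div_of_nonneg_left (norm_nonneg _) (mnorm_pos q₁ hz)
            (mnorm_anti (by linarith) hq hz)
  · push Not at hne
    simp [bcmsv, hne]
end
end

section
/- The q-ratio block sparsity is non-increasing in q: for reals 1 < q ≤ q' < ∞ and any nonzero block signal x, (‖x‖_{2,1}/‖x‖_{2,q'})^{q'/(q'-1)} ≤ (‖x‖_{2,1}/‖x‖_{2,q})^{q/(q-1)}, i.e. k_{q'}(x) ≤ k_q(x). -/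
open Finset in
/-- A Jensen-type interpolation inequality between power sums. -/
lemma rpow_sum_rpow_div_sum_le {ι : Type*} (s : Finset ι) (a : ι → ℝ) (ha : ∀ i ∈ s, 0 ≤ a i)
    (hA : 0 < ∑ i ∈ s, a i) {q q' : ℝ} (hq : 1 < q) (hqq' : q ≤ q') :
    ((∑ i ∈ s, a i ^ q) / ∑ i ∈ s, a i) ^ ((q' - 1) / (q - 1)) ≤
      (∑ i ∈ s, a i ^ q') / ∑ i ∈ s, a i := by
  have hq1 : 0 < q - 1 := by linarith
  have mul_rpow_sub_one : ∀ r : ℝ, 1 < r → ∀ i ∈ s, a i * a i ^ (r - 1) = a i ^ r := by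
    intro r hr i hi
    rw [← Real.rpow_one_add' (ha i hi) (by linarith), add_sub_cancel]
  have jensen := Real.rpow_arith_mean_le_arith_mean_rpow s
    (fun i ↦ a i / ∑ j ∈ s, a j) (fun i ↦ a i ^ (q - 1))
    (fun i hi ↦ div_nonneg (ha i hi) hA.le) (by rw [← sum_div, div_self hA.ne'])
    (fun i hi ↦ Real.rpow_nonneg (ha i hi) _)
    (p := (q' - 1) / (q - 1)) (by rw [le_div_iff₀ hq1]; linarith)
  rw [sum_div, sum_div]
  convert jensen using 2
  · refine sum_congr rfl fun i hi ↦ ?_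
    rw [div_mul_eq_mul_div, mul_rpow_sub_one q hq i hi]
  · rename_i i hi
    rw [← Real.rpow_mul (ha i hi), mul_div_cancel₀ _ hq1.ne', div_mul_eq_mul_div,
      mul_rpow_sub_one q' (by linarith) i hi]


open scoped BigOperators

noncomputable section

/-- The q-ratio block sparsity is non-increasing in q: for 1 < q ≤ q' and x ≠ 0,
k_{q'}(x) ≤ k_q(x). -/
theorem stmt_3 {p n : ℕ} (q q' : ℝ) (hq : 1 < q) (hqq' : q ≤ q')
    (x : Fin p → EuclideanSpace ℝ (Fin n)) (hx : x ≠ 0) :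
    (mnorm1 x / mnorm q' x) ^ (q' / (q' - 1)) ≤ (mnorm1 x / mnorm q x) ^ (q / (q - 1)) := by
  have hq1 : 0 < q - 1 := by linarith
  have hq'1 : 0 < q' - 1 := by linarith
  obtain ⟨i, hi⟩ := Function.ne_iff.mp hx
  have hi : 0 < ‖x i‖ := norm_pos_iff.mpr hi
  have sum_pos : ∀ r : ℝ, 0 < ∑ i, ‖x i‖ ^ r := fun r ↦
    Finset.sum_pos' (fun j _ ↦ by positivity) ⟨i, Finset.mem_univ i, by positivity⟩
  have hA : 0 < ∑ i, ‖x i‖ := by simpa using sum_pos 1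
  have hS := sum_pos q
  have hT := sum_pos q'
  have key := rpow_sum_rpow_div_sum_le Finset.univ (fun i ↦ ‖x i‖) (fun _ _ ↦ norm_nonneg _)
    hA hq hqq'
  simp only [mnorm1, mnorm]
  generalize ∑ i, ‖x i‖ = A at *
  generalize ∑ i, ‖x i‖ ^ q = S at *
  generalize ∑ i, ‖x i‖ ^ q' = T at *
  rw [← Real.log_le_log_iff (by positivity) (by positivity), Real.log_rpow (by positivity),
    Real.log_div hS.ne' hA.ne', Real.log_div hT.ne' hA.ne', div_mul_eq_mul_div,
    div_le_iff₀ hq1] at key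
  rw [← Real.log_le_log_iff (by positivity) (by positivity), Real.log_rpow (by positivity),
    Real.log_rpow (by positivity), Real.log_div hA.ne' (by positivity),
    Real.log_div hA.ne' (by positivity), Real.log_rpow hS, Real.log_rpow hT]
  have log_form : ∀ r L : ℝ, 1 < r →
      r / (r - 1) * (Real.log A - 1 / r * L) = (r * Real.log A - L) / (r - 1) := by
    intro r L hr
    have : r ≠ 0 := by linarith
    field_simp
  rw [log_form q' _ (by linarith), log_form q _ hq, div_le_div_iff₀ hq'1 hq1]
  linarith
end
end

section
/- Mixed ℓ₂/ℓ_q error bound for the block Basis Pursuit (BBP) with block k-sparse signals: let q > 1 be real, k ≥ 1, x block k-sparse, ζ ≥ 0, ε with ‖ε‖₂ ≤ ζ, and y = A x + ε. Let x̂ satisfy ‖y − A x̂‖₂ ≤ ζ and ‖x̂‖_{2,1} ≤ ‖z‖_{2,1} for every z with ‖y − A z‖₂ ≤ ζ. Suppose β > 0 is such that ‖A z‖₂ ≥ β·‖z‖_{2,q} for every z with ‖z‖_{2,1} ≤ 2·k^{1-1/q}·‖z‖_{2,q} (i.e. β is a lower bound for β_{q,2^{q/(q-1)}k}(A)). Then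 ‖x̂ − x‖_{2,q} ≤ 2ζ/β. -/
open scoped BigOperators

noncomputable section

theorem mnorm1_sub_le_two_mul_sum {p n : ℕ} {x xh : Fin p → EuclideanSpace ℝ (Fin n)}
    {S : Finset (Fin p)} (hS : ∀ i ∉ S, x i = 0) (h : mnorm1 xh ≤ mnorm1 x) :
    mnorm1 (xh - x) ≤ 2 * ∑ i ∈ S, ‖(xh - x) i‖ := by
  have key : ∑ i, (‖(xh - x) i‖ + ‖x i‖ - ‖xh i‖) ≤
      ∑ i, if i ∈ S then 2 * ‖(xh - x) i‖ else 0 := by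
    refine Finset.sum_le_sum fun i _ => ?_
    split_ifs with hi
    · have := norm_sub_norm_le (x i) (xh i)
      rw [norm_sub_rev] at this
      simp only [Pi.sub_apply]
      linarith
    · simp [hS i hi]
  rw [Finset.sum_ite_mem, Finset.univ_inter, ← Finset.mul_sum, Finset.sum_sub_distrib,
    Finset.sum_add_distrib] at key
  unfold mnorm1 at *
  linarith

theorem sum_norm_le_card_rpow_mul_mnorm {p n : ℕ} {q : ℝ} (hq : 1 ≤ q)
    (z : Fin p → EuclideanSpace ℝ (Fin n)) (S : Finset (Fin p)) :
    ∑ i ∈ S, ‖z i‖ ≤ (S.card : ℝ) ^ (1 - 1 / q) * mnorm q z := by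
  have hq0 : 0 < q := by linarith
  have hsum : (∑ i ∈ S, ‖z i‖) ^ q ≤ (S.card : ℝ) ^ (q - 1) * ∑ i, ‖z i‖ ^ q := by
    have hpow := Real.rpow_sum_le_const_mul_sum_rpow S (fun i => ‖z i‖) hq
    simp only [abs_norm] at hpow
    refine hpow.trans ?_
    gcongr
    exact Finset.subset_univ S
  have hroot := Real.rpow_le_rpow (by positivity) hsum (by positivity : 0 ≤ 1 / q)
  rw [Real.mul_rpow (by positivity) (by positivity), ← Real.rpow_mul (by positivity),
    ← Real.rpow_mul (by positivity), mul_one_div_cancel hq0.ne', Real.rpow_one,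
    sub_mul, one_mul, mul_one_div_cancel hq0.ne'] at hroot
  exact hroot

/-- Mixed ℓ₂/ℓ_q error bound for the block Basis Pursuit with block k-sparse signals. -/
theorem stmt_5 {p n m : ℕ}
    (A : (Fin p → EuclideanSpace ℝ (Fin n)) →ₗ[ℝ] EuclideanSpace ℝ (Fin m))
    (q : ℝ) (hq : 1 < q) (k : ℕ) (hk : 1 ≤ k)
    (x : Fin p → EuclideanSpace ℝ (Fin n))
    (hx : ∃ S : Finset (Fin p), S.card ≤ k ∧ ∀ i ∉ S, x i = 0)
    (ζ : ℝ) (hζ : 0 ≤ ζ)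
    (ε : EuclideanSpace ℝ (Fin m)) (hε : ‖ε‖ ≤ ζ)
    (y : EuclideanSpace ℝ (Fin m)) (hy : y = A x + ε)
    (xh : Fin p → EuclideanSpace ℝ (Fin n))
    (hfeas : ‖y - A xh‖ ≤ ζ)
    (hmin : ∀ z : Fin p → EuclideanSpace ℝ (Fin n), ‖y - A z‖ ≤ ζ → mnorm1 xh ≤ mnorm1 z)
    (β : ℝ) (hβ : 0 < β)
    (hcmsv : ∀ z : Fin p → EuclideanSpace ℝ (Fin n),
      mnorm1 z ≤ 2 * (k : ℝ) ^ (1 - 1 / q) * mnorm q z → β * mnorm q z ≤ ‖A z‖) :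
    mnorm q (xh - x) ≤ 2 * ζ / β := by
  obtain ⟨S, hSk, hS⟩ := hx
  have hxfeas : ‖y - A x‖ ≤ ζ := by simpa [hy] using hε
  have hq0 : 0 ≤ 1 - 1 / q := by
    rw [sub_nonneg, div_le_one (by linarith)]
    exact hq.le
  have hcone : mnorm1 (xh - x) ≤ 2 * (k : ℝ) ^ (1 - 1 / q) * mnorm q (xh - x) := by
    have hnonneg : 0 ≤ mnorm q (xh - x) := by unfold mnorm; positivity
    calc mnorm1 (xh - x) ≤ 2 * ∑ i ∈ S, ‖(xh - x) i‖ :=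
          mnorm1_sub_le_two_mul_sum hS (hmin x hxfeas)
      _ ≤ 2 * ((S.card : ℝ) ^ (1 - 1 / q) * mnorm q (xh - x)) := by
          gcongr
          exact sum_norm_le_card_rpow_mul_mnorm hq.le _ S
      _ ≤ 2 * ((k : ℝ) ^ (1 - 1 / q) * mnorm q (xh - x)) := by gcongr
      _ = _ := by ring
  have htube : ‖A (xh - x)‖ ≤ 2 * ζ := by
    calc ‖A (xh - x)‖ = ‖(y - A x) - (y - A xh)‖ := by rw [map_sub, sub_sub_sub_cancel_left]
      _ ≤ ‖y - A x‖ + ‖y - A xh‖ := norm_sub_le _ _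
      _ ≤ 2 * ζ := by linarith
  rw [le_div_iff₀ hβ, mul_comm]
  exact (hcmsv _ hcone).trans htube
end
end

section
/- Cone condition for ℓ₂/ℓ₁ minimizers over block k-sparse signals: let k ≥ 1, let S be a set of at most k block indices, let x be a block signal whose blocks vanish outside S, and let x̂ satisfy ‖x̂‖_{2,1} ≤ ‖x‖_{2,1}. Set h = x̂ − x. Then ‖h_{S^c}‖_{2,1} ≤ ‖h_S‖_{2,1}, and consequently for every real q > 1, ‖h‖_{2,1} ≤ 2·k^{1-1/q}·‖h‖_{2,q} (equivalently k_q(h) ≤ 2^{q/(q-1)}·k when h ≠ 0). -/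
open scoped BigOperators

noncomputable section

/-- **Hölder's inequality** against the constant function: the sum of nonnegative reals over `s`
is at most `#s ^ (1 - 1 / q)` times their `ℓ_q` norm. -/
theorem sum_le_card_rpow_mul_rpow_sum {ι : Type*} (s : Finset ι) {f : ι → ℝ}
    (hf : ∀ i ∈ s, 0 ≤ f i) {q : ℝ} (hq : 1 < q) :
    ∑ i ∈ s, f i ≤ (s.card : ℝ) ^ (1 - 1 / q) * (∑ i ∈ s, f i ^ q) ^ (1 / q) := by
  have hpq : q.HolderConjugate (q / (q - 1)) := .conjExponent hq
  have h := Real.inner_le_Lp_mul_Lq_of_nonneg s hpq hf (fun _ _ => zero_le_one)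
  have hexp : 1 / (q / (q - 1)) = 1 - 1 / q := by
    have : q ≠ 0 := by linarith
    field_simp
  simpa [hexp, mul_comm] using h

/-- Perturbing a family supported on `S` without increasing its `ℓ₁` norm moves at least as much
mass inside `S` as outside. -/
theorem sum_compl_norm_sub_le {ι E : Type*} [Fintype ι] [DecidableEq ι]
    [SeminormedAddCommGroup E] {S : Finset ι} {x y : ι → E} (hx : ∀ i ∉ S, x i = 0)
    (hle : ∑ i, ‖y i‖ ≤ ∑ i, ‖x i‖) :
    ∑ i ∈ Sᶜ, ‖(y - x) i‖ ≤ ∑ i ∈ S, ‖(y - x) i‖ := by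
  have hcompl : ∑ i ∈ Sᶜ, ‖(y - x) i‖ = ∑ i ∈ Sᶜ, ‖y i‖ :=
    Finset.sum_congr rfl fun i hi => by simp [hx i (Finset.mem_compl.mp hi)]
  have hzero : ∑ i ∈ Sᶜ, ‖x i‖ = 0 :=
    Finset.sum_eq_zero fun i hi => by simp [hx i (Finset.mem_compl.mp hi)]
  have htri : ∑ i ∈ S, ‖x i‖ ≤ ∑ i ∈ S, ‖y i‖ + ∑ i ∈ S, ‖(y - x) i‖ := by
    rw [← Finset.sum_add_distrib]
    exact Finset.sum_le_sum fun i _ => norm_le_norm_add_norm_sub (y i) (x i)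
  rw [← Finset.sum_add_sum_compl S, ← Finset.sum_add_sum_compl S fun i => ‖x i‖] at hle
  linarith

/-- Cone condition for ℓ₂/ℓ₁ minimizers over block k-sparse signals. -/
theorem stmt_17 {p n : ℕ} (k : ℕ) (hk : 1 ≤ k)
    (S : Finset (Fin p)) (hS : S.card ≤ k)
    (x : Fin p → EuclideanSpace ℝ (Fin n)) (hx : ∀ i ∉ S, x i = 0)
    (xh : Fin p → EuclideanSpace ℝ (Fin n)) (hmin : mnorm1 xh ≤ mnorm1 x) :
    (∑ i ∈ Sᶜ, ‖(xh - x) i‖) ≤ (∑ i ∈ S, ‖(xh - x) i‖) ∧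
      ∀ q : ℝ, 1 < q → mnorm1 (xh - x) ≤ 2 * (k : ℝ) ^ (1 - 1 / q) * mnorm q (xh - x) := by
  have hcone := sum_compl_norm_sub_le hx hmin
  refine ⟨hcone, fun q hq => ?_⟩
  have hq0 : 0 < q := by linarith
  have hexp : 0 ≤ 1 - 1 / q := sub_nonneg.mpr ((div_le_one hq0).mpr hq.le)
  have hsum : ∑ i ∈ S, ‖(xh - x) i‖ ^ q ≤ ∑ i, ‖(xh - x) i‖ ^ q :=
    Finset.sum_le_sum_of_subset_of_nonneg (Finset.subset_univ S) fun _ _ _ => by positivity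
  calc mnorm1 (xh - x) = ∑ i ∈ S, ‖(xh - x) i‖ + ∑ i ∈ Sᶜ, ‖(xh - x) i‖ :=
        (Finset.sum_add_sum_compl S _).symm
    _ ≤ 2 * ∑ i ∈ S, ‖(xh - x) i‖ := by linarith
    _ ≤ 2 * ((S.card : ℝ) ^ (1 - 1 / q) * (∑ i ∈ S, ‖(xh - x) i‖ ^ q) ^ (1 / q)) := by
        gcongr
        exact sum_le_card_rpow_mul_rpow_sum S (fun _ _ => norm_nonneg _) hq
    _ ≤ 2 * ((k : ℝ) ^ (1 - 1 / q) * (∑ i, ‖(xh - x) i‖ ^ q) ^ (1 / q)) := by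
        gcongr
    _ = 2 * (k : ℝ) ^ (1 - 1 / q) * mnorm q (xh - x) := by rw [mnorm, mul_assoc]
end
end

section
/- Group lasso ℓ₂/ℓ₁ comparison inequality: let κ > 0, μ > 0, let ε satisfy ‖Aᵀε‖_{2,∞} ≤ κμ, let y = A x + ε, and let x̂ satisfy (1/2)‖A x̂ − y‖₂² + μ‖x̂‖_{2,1} ≤ (1/2)‖A x − y‖₂² + μ‖x‖_{2,1}. Then ‖x̂‖_{2,1} ≤ κ·‖x̂ − x‖_{2,1} + ‖x‖_{2,1}. -/
open scoped BigOperators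

noncomputable section

/-- Mixed ℓ₂/ℓ_∞ norm of a block signal: the largest block norm. -/
def mnormInf {p n : ℕ} (x : Fin p → EuclideanSpace ℝ (Fin n)) : ℝ := ⨆ i, ‖x i‖

/-- Hölder's inequality for the mixed norms: the inner product is bounded by the ℓ₂/ℓ₁ norm of one
factor times the ℓ₂/ℓ_∞ norm of the other. -/
lemma inner_le_mnorm1_mul_mnormInf {p n : ℕ}
    (x y : PiLp 2 (fun _ : Fin p => EuclideanSpace ℝ (Fin n))) :
    inner ℝ x y ≤ mnorm1 x * mnormInf y := by
  rw [PiLp.inner_apply, mnorm1, Finset.sum_mul]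
  refine Finset.sum_le_sum fun i _ => (real_inner_le_norm _ _).trans ?_
  exact mul_le_mul_of_nonneg_left
    (le_ciSup (f := fun j => ‖y j‖) (Set.finite_range _).bddAbove i) (norm_nonneg _)

/-- Group lasso ℓ₂/ℓ₁ comparison inequality. -/
theorem stmt_18 {p n m : ℕ}
    (A : PiLp 2 (fun _ : Fin p => EuclideanSpace ℝ (Fin n)) →L[ℝ] EuclideanSpace ℝ (Fin m))
    (κ : ℝ) (hκ : 0 < κ) (μ : ℝ) (hμ : 0 < μ)
    (x : PiLp 2 (fun _ : Fin p => EuclideanSpace ℝ (Fin n)))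
    (ε : EuclideanSpace ℝ (Fin m))
    (hε : mnormInf (ContinuousLinearMap.adjoint A ε) ≤ κ * μ)
    (y : EuclideanSpace ℝ (Fin m)) (hy : y = A x + ε)
    (xh : PiLp 2 (fun _ : Fin p => EuclideanSpace ℝ (Fin n)))
    (hobj : (1 / 2) * ‖A xh - y‖ ^ 2 + μ * mnorm1 xh ≤
      (1 / 2) * ‖A x - y‖ ^ 2 + μ * mnorm1 x) :
    mnorm1 xh ≤ κ * mnorm1 (xh - x) + mnorm1 x := by
  have h_res : A xh - y = A (xh - x) - ε := by rw [hy, map_sub]; abel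
  have h_noise : A x - y = -ε := by rw [hy]; abel
  rw [h_res, h_noise, norm_neg, norm_sub_sq_real,
    ← ContinuousLinearMap.adjoint_inner_right] at hobj
  have h_nonneg : 0 ≤ mnorm1 (xh - x) := Finset.sum_nonneg fun i _ => norm_nonneg _
  have h_inner : inner ℝ (xh - x) (ContinuousLinearMap.adjoint A ε) ≤
      mnorm1 (xh - x) * (κ * μ) :=
    (inner_le_mnorm1_mul_mnormInf _ _).trans (mul_le_mul_of_nonneg_left hε h_nonneg)
  refine le_of_mul_le_mul_left ?_ hμ
  nlinarith [sq_nonneg ‖A (xh - x)‖]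
end
end
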